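/- arXiv:2509.04540 — 2 statements merged into one kernel-verified Lean document; each statement's English description precedes it below -/
import Mathlib

section
/- Gaussian sum over a finite field vector space: let ℓ be an odd prime, Q a non-degenerate symmetric n×n matrix over 𝔽_ℓ. Then ∑_{x ∈ 𝔽_ℓⁿ} exp(2πi (xᵀQx)/ℓ) = ℓ^{n/2} (det Q / ℓ) ε_ℓⁿ, where ε_ℓ = 1 if ℓ ≡ 1 mod 4 and ε_ℓ = i if ℓ ≡ 3 mod 4, and (·/ℓ) is the Legendre symbol. -/
/-- Gaussian binomials via Pascal. -/
def qB (q : ℂ) : ℕ → ℕ → ℂ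
  | _, 0 => 1
  | 0, _ + 1 => 0
  | m + 1, k + 1 => qB q m k + q ^ (k + 1) * qB q m (k + 1)

theorem qB_ss (q : ℂ) (m k : ℕ) :
    qB q (m + 1) (k + 1) = qB q m k + q ^ (k + 1) * qB q m (k + 1) := rfl

theorem qB_zero (q : ℂ) (m : ℕ) : qB q m 0 = 1 := by cases m <;> simp [qB]

theorem qB_H (q : ℂ) (m : ℕ) : ∀ k, (q ^ k - q ^ m) * qB q m k
    = q ^ k * (1 - q ^ (k + 1)) * qB q m (k + 1) := by
  induction m with
  | zero => intro k; cases k <;> simp [qB]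
  | succ m ih =>
    intro k
    have h1 := ih k
    cases k with
    | zero =>
      simp only [qB, qB_zero] at h1 ⊢
      linear_combination q * h1
    | succ k =>
      have h0 := ih k
      simp only [qB] at h1 ⊢
      linear_combination q * h0 + q ^ (k+2) * h1

theorem qB_A (q : ℂ) (m k : ℕ) : (1 - q ^ (k + 1)) * qB q (m + 1) (k + 1)
    = (1 - q ^ (m + 1)) * qB q m k := by
  by_cases hq : q = 0
  · subst hq; simp [qB]
  have := qB_H q m k
  have h2 : q ^ k ≠ 0 := pow_ne_zero _ hq
  simp only [qB]
  linear_combination (-q) * this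

theorem qB_gt (q : ℂ) (m : ℕ) : ∀ k, m < k → qB q m k = 0 := by
  induction m with
  | zero => intro k hk; cases k <;> simp_all [qB]
  | succ m ih =>
    intro k hk
    cases k with
    | zero => omega
    | succ k => simp [qB, ih k (by omega), ih (k+1) (by omega)]

theorem qB_self (q : ℂ) (m : ℕ) : qB q m m = 1 := by
  induction m with
  | zero => simp [qB]
  | succ m ih => simp [qB, ih, qB_gt q m (m+1) (by omega)]

def qF (q : ℂ) (m : ℕ) : ℂ := ∑ k ∈ Finset.range (m + 1), (-1) ^ k * qB q m k

theorem qF_succ (q : ℂ) (m : ℕ) : qF q (m + 2) = (1 - q ^ (m + 1)) * qF q m := by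
  have e : qF q (m+2) = ∑ k ∈ Finset.range (m+2), (-1)^k * (q^k - 1) * qB q (m+1) k := by
    unfold qF
    rw [Finset.sum_range_succ']
    simp only [qB_ss q (m + 1), qB_zero]
    have : ∑ k ∈ Finset.range (m+2), (-1 : ℂ)^k * q^k * qB q (m+1) k 
       = ∑ k ∈ Finset.range (m+2), (-1 : ℂ)^(k+1) * q^(k+1) * qB q (m+1) (k+1) + 1 := by
      rw [Finset.sum_range_succ', Finset.sum_range_succ _ (m+1), qB_gt q (m+1) (m+1+1) (by omega)]
      simp [qB_zero]
    have h2 : ∑ k ∈ Finset.range (m+2), (-1 : ℂ)^k * (q^k - 1) * qB q (m+1) k = 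
       ∑ k ∈ Finset.range (m+2), (-1 : ℂ)^k * q^k * qB q (m+1) k - 
         ∑ k ∈ Finset.range (m+2), (-1 : ℂ)^k * qB q (m+1) k := by
      rw [← Finset.sum_sub_distrib]; exact Finset.sum_congr rfl fun k _ => by ring
    rw [h2, this, sub_eq_add_neg, ← Finset.sum_neg_distrib, add_right_comm, ← Finset.sum_add_distrib]
    simp only [pow_zero, one_mul]
    congr 1
    exact Finset.sum_congr rfl fun k _ => by ring
  rw [e, Finset.sum_range_succ', qF, Finset.mul_sum]
  simp only [pow_zero, sub_self, mul_zero, zero_mul, add_zero]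
  refine Finset.sum_congr rfl fun k _ => ?_
  have := qB_A q m k
  linear_combination (-1)^k * this

theorem qF_even (q : ℂ) (r : ℕ) : qF q (2 * r) = ∏ i ∈ Finset.range r, (1 - q ^ (2 * i + 1)) := by
  induction r with
  | zero => simp [qF, qB]
  | succ r ih => rw [Finset.prod_range_succ, ← ih, mul_comm (qF q (2 * r)), ← qF_succ]; rfl

theorem qB_root (q : ℂ) (p : ℕ) (hq : IsPrimitiveRoot q (p + 1)) (k : ℕ) (hk : k ≤ p) :
    qB q p k * q ^ (k * (k + 1) / 2) = (-1) ^ k := by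
  induction k with
  | zero => simp [qB_zero]
  | succ k ih =>
    have h := qB_A q p k
    rw [hq.pow_eq_one, sub_self, zero_mul] at h
    have h1 : 1 - q ^ (k+1) ≠ 0 := by
      rw [sub_ne_zero]; exact (hq.pow_ne_one_of_pos_of_lt (by omega) (by omega)).symm
    have h2 : qB q p k + q ^ (k + 1) * qB q p (k + 1) = 0 := by
      simpa [h1, qB] using h
    have e : (k+1) * (k+1+1) / 2 = k * (k+1) / 2 + (k+1) := by
      rw [show (k+1)*(k+1+1) = k * (k+1) + 2 * (k+1) by ring]; omega
    rw [e, pow_add]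
    linear_combination q ^ (k * (k + 1) / 2) * h2 - ih (by omega)

theorem gauss_prod (r : ℕ) (z : ℂ) (hz : IsPrimitiveRoot z (2 * r + 1)) :
    ∑ k ∈ Finset.range (2 * r + 1), z ^ (k * (k + 1) + r ^ 2) =
      ∏ i ∈ Finset.range r, (z ^ (2 * i + 1) - (z ^ (2 * i + 1))⁻¹) := by
  have z0 : z ≠ 0 := hz.ne_zero (by omega)
  have hq : IsPrimitiveRoot (z⁻¹ ^ 2) (2 * r + 1) :=
    hz.inv.pow_of_coprime 2 (by simp)
  have h1 := qF_even (z⁻¹ ^ 2) r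
  have h2 : qF (z⁻¹ ^ 2) (2 * r) = ∑ k ∈ Finset.range (2 * r + 1), z ^ (k * (k + 1)) := by
    refine Finset.sum_congr rfl fun k hk => ?_
    have := qB_root _ _ hq k (by simp at hk; omega)
    rw [← pow_mul, Nat.mul_div_cancel' (Nat.even_mul_succ_self k).two_dvd, inv_pow z (k * _)] at this
    rw [mul_inv_eq_iff_eq_mul₀ (pow_ne_zero _ z0)] at this
    rw [this, ← mul_assoc, ← mul_pow]; simp
  have h3 : z ^ (r ^ 2) = ∏ i ∈ Finset.range r, z ^ (2 * i + 1) := by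
    rw [Finset.prod_pow_eq_pow_sum]
    congr 1
    clear * -
    induction r with
    | zero => simp
    | succ r ih => rw [Finset.sum_range_succ, ← ih]; ring
  simp_rw [pow_add _ _ (r^2), ← Finset.sum_mul]
  rw [← h2, h1, h3, ← Finset.prod_mul_distrib]
  refine Finset.prod_congr rfl fun i _ => ?_
  have : z ^ (2 * i + 1) ≠ 0 := pow_ne_zero _ z0
  rw [← pow_mul, mul_comm 2, pow_mul, inv_pow]
  field_simp

theorem sin_prod (r : ℕ) : ∃ c : ℝ, 0 < c ∧
    ∏ i ∈ Finset.range r, (2 * Complex.I * (Real.sin (2 * Real.pi * (2 * i + 1 : ℕ) / (2 * r + 1 : ℕ)) : ℂ))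
      = c * (if (2 * r + 1) % 4 = 1 then 1 else Complex.I) := by
  set s : ℕ → ℝ := fun i => Real.sin (2 * Real.pi * (2 * i + 1 : ℕ) / (2 * r + 1 : ℕ)) with hs
  have hp : (0 : ℝ) < (2 * r + 1 : ℕ) := by positivity
  have hpos : ∀ i, 2 * i + 1 ≤ r → 0 < s i := by
    intro i hi
    apply Real.sin_pos_of_pos_of_lt_pi
    · positivity
    · rw [div_lt_iff₀ hp]
      have : (2 : ℝ) * (2 * i + 1 : ℕ) < (2 * r + 1 : ℕ) := by exact_mod_cast (by omega)
      nlinarith [Real.pi_pos]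
  have hneg : ∀ i, r < 2 * i + 1 → i < r → 0 < - s i := by
    intro i hi hr
    have : - s i = Real.sin (2 * Real.pi * (2 * i + 1 : ℕ) / (2 * r + 1 : ℕ) - Real.pi) := by
      rw [Real.sin_sub_pi]
    rw [this]
    have h1 : ((2 * r + 1 : ℕ) : ℝ) < 2 * (2 * i + 1 : ℕ) := by exact_mod_cast (by omega)
    have h2 : ((2 * i + 1 : ℕ) : ℝ) < (2 * r + 1 : ℕ) := by exact_mod_cast (by omega)
    apply Real.sin_pos_of_pos_of_lt_pi
    · rw [sub_pos, lt_div_iff₀ hp]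
      nlinarith [Real.pi_pos]
    · rw [sub_lt_iff_lt_add, div_lt_iff₀ hp]
      nlinarith [Real.pi_pos]
  set a := (r + 1) / 2 with ha
  set b := r / 2 with hb
  have hab : r = a + b := by omega
  refine ⟨2 ^ r * ((∏ i ∈ Finset.range a, s i) * ∏ i ∈ Finset.range b, (- s (a + i))), ?_, ?_⟩
  · refine mul_pos (by positivity) (mul_pos (Finset.prod_pos fun i hi => hpos i ?_)
      (Finset.prod_pos fun i hi => hneg _ ?_ ?_))
    all_goals simp only [Finset.mem_range] at hi; omega
  · have hI : Complex.I ^ r * (-1) ^ b = if (2 * r + 1) % 4 = 1 then 1 else Complex.I := by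
      have h1 : Complex.I ^ (2 * b) * (-1) ^ b = 1 := by
        rw [pow_mul, Complex.I_sq, ← mul_pow]; simp
      split_ifs with h
      · rwa [show r = 2 * b by omega]
      · rw [show r = 2 * b + 1 by omega, pow_succ, mul_right_comm, h1, one_mul]
    rw [Finset.prod_mul_distrib, Finset.prod_const, Finset.card_range, mul_pow, ← hI,
      Finset.prod_neg, Finset.card_range]
    have : ∏ i ∈ Finset.range r, (s i : ℂ) =
        (∏ i ∈ Finset.range a, (s i : ℂ)) * ∏ i ∈ Finset.range b, (s (a + i) : ℂ) := by
      rw [hab, Finset.prod_range_add]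
    rw [this]
    push_cast
    have hb2 : ((-1 : ℂ) ^ b) * (-1) ^ b = 1 := by rw [← mul_pow]; simp
    linear_combination (-(2 ^ r * Complex.I ^ r * (∏ i ∈ Finset.range a, (s i : ℂ)) *
      ∏ i ∈ Finset.range b, (s (a + i) : ℂ))) * hb2

theorem sum_zmod (p : ℕ) [NeZero p] (f : ZMod p → ℂ) :
    ∑ x, f x = ∑ k ∈ Finset.range p, f (k : ZMod p) := by
  refine Finset.sum_nbij' (fun x => x.val) (fun k => (k : ZMod p)) ?_ ?_ ?_ ?_ ?_
  · intro x _; simpa using ZMod.val_lt x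
  · simp
  · intro x _; simp
  · intro k hk; simp at hk; exact ZMod.val_cast_of_lt hk
  · intro x _; simp

theorem std_nat (p : ℕ) [NeZero p] (k : ℕ) : ZMod.stdAddChar (k : ZMod p) =
    Complex.exp (2 * Real.pi * Complex.I * k / p) := by
  have := ZMod.stdAddChar_coe (N := p) (k : ℤ)
  simpa using this

theorem gauss_eps (p : ℕ) [Fact p.Prime] (hp : p ≠ 2) : ∃ c : ℝ, 0 < c ∧
    ∑ x : ZMod p, ZMod.stdAddChar (x ^ 2) = c * (if p % 4 = 1 then 1 else Complex.I) := by
  obtain ⟨r, hr⟩ := (Fact.out : p.Prime).odd_of_ne_two hp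
  obtain ⟨c, hc, h⟩ := sin_prod r
  refine ⟨c, hc, ?_⟩
  rw [← hr] at h
  rw [← h]
  set z := Complex.exp (2 * Real.pi * Complex.I / p) with hz
  have hzp : IsPrimitiveRoot z (2 * r + 1) := by
    rw [← hr]; exact Complex.isPrimitiveRoot_exp p (NeZero.ne p)
  have hpow : ∀ k : ℕ, ZMod.stdAddChar (k : ZMod p) = z ^ k := by
    intro k
    rw [std_nat, hz, ← Complex.exp_nat_mul]; congr 1; ring
  have hr2 : (2 * r + 1 : ZMod p) = 0 := by
    have : ((2 * r + 1 : ℕ) : ZMod p) = 0 := by rw [← hr]; simp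
    exact_mod_cast this
  have key := gauss_prod r z hzp
  rw [← Equiv.sum_comp (Equiv.subRight (r : ZMod p)), sum_zmod]
  trans ∑ k ∈ Finset.range (2 * r + 1), z ^ (k * (k + 1) + r ^ 2)
  · rw [← hr]
    refine Finset.sum_congr rfl fun k _ => ?_
    rw [← hpow]
    congr 1
    push_cast [Equiv.subRight_apply]
    linear_combination (-(k : ZMod p)) * hr2
  rw [key]
  refine Finset.prod_congr rfl fun i _ => ?_
  rw [hz, ← Complex.exp_nat_mul, ← Complex.exp_neg, Complex.ofReal_sin, Complex.sin]
  have e : ((2 * i + 1 : ℕ) : ℂ) * (2 * Real.pi * Complex.I / p) =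
    ((2 * Real.pi * (2 * i + 1 : ℕ) / p : ℝ) : ℂ) * Complex.I := by push_cast; ring
  rw [e, neg_mul]
  linear_combination (Complex.exp (((2 * Real.pi * (2 * i + 1 : ℕ) / p : ℝ) : ℂ) * Complex.I) - Complex.exp (-(((2 * Real.pi * (2 * i + 1 : ℕ) / p : ℝ) : ℂ) * Complex.I))) * Complex.I_sq

/-- the complex quadratic character -/
noncomputable def chiC (p : ℕ) [Fact p.Prime] : MulChar (ZMod p) ℂ :=
  (quadraticChar (ZMod p)).ringHomComp (Int.castRingHom ℂ)

theorem sum_sq_eq (p : ℕ) [Fact p.Prime] (hp : p ≠ 2) (a : ZMod p) (ha : a ≠ 0) :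
    ∑ x : ZMod p, ZMod.stdAddChar (a * x ^ 2) =
      gaussSum (chiC p) (ZMod.stdAddChar.mulShift a) := by
  have hF : ringChar (ZMod p) ≠ 2 := by rwa [ZMod.ringChar_zmod_n]
  have h0 : ∑ y : ZMod p, ZMod.stdAddChar (a * y) = 0 := by
    have := AddChar.sum_mulShift (R := ZMod p) (R' := ℂ) a (ZMod.isPrimitive_stdAddChar p)
    simpa [ha, mul_comm] using this
  have h1 : ∑ x : ZMod p, ZMod.stdAddChar (a * x ^ 2) =
      ∑ y : ZMod p, ((quadraticChar (ZMod p) y + 1 : ℤ) : ℂ) * ZMod.stdAddChar (a * y) := by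
    rw [← Finset.sum_fiberwise (s := Finset.univ) (g := fun x : ZMod p => x ^ 2)]
    refine Finset.sum_congr rfl fun y _ => ?_
    rw [← quadraticChar_card_sqrts hF y]
    rw [Finset.sum_congr rfl (g := fun _ => ZMod.stdAddChar (a * y))]
    · rw [Finset.sum_const, nsmul_eq_mul]
      congr 2
      congr 2
      ext; simp
    · intro x hx
      simp at hx
      rw [hx]
  rw [h1]
  push_cast
  simp only [add_mul, one_mul, Finset.sum_add_distrib, h0, add_zero]
  simp [gaussSum, chiC, AddChar.mulShift_apply]

theorem gauss_one (p : ℕ) [Fact p.Prime] (hp : p ≠ 2) :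
    ∑ x : ZMod p, ZMod.stdAddChar (x ^ 2) = Real.sqrt p * (if p % 4 = 1 then 1 else Complex.I) := by
  have hF : ringChar (ZMod p) ≠ 2 := by rwa [ZMod.ringChar_zmod_n]
  obtain ⟨c, hc, h⟩ := gauss_eps p hp
  have h1 := sum_sq_eq p hp 1 one_ne_zero
  simp only [one_mul, AddChar.mulShift_one] at h1
  have h2 : gaussSum (chiC p) ZMod.stdAddChar ^ 2 = chiC p (-1) * Fintype.card (ZMod p) :=
    gaussSum_sq ((MulChar.ringHomComp_ne_one_iff (RingHom.injective_int _)).mpr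
      (quadraticChar_ne_one hF)) ((quadraticChar_isQuadratic _).comp _)
      (ZMod.isPrimitive_stdAddChar p)
  rw [← h1, h, ZMod.card] at h2
  have h3 : c ^ 2 = p := by
    have h4 := congrArg norm h2
    have h5 : ‖chiC p (-1)‖ = 1 := by
      have : chiC p (-1) ^ 2 = 1 := by rw [← map_pow]; simp
      have := congrArg norm this
      rw [norm_pow, norm_one] at this
      exact (pow_eq_one_iff_of_nonneg (norm_nonneg _) two_ne_zero).mp this
    have h6 : ‖(if p % 4 = 1 then 1 else Complex.I : ℂ)‖ = 1 := by split_ifs <;> simp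
    rw [norm_pow, norm_mul, norm_mul, h5, h6] at h4
    simpa using h4
  rw [h, ← h3, Real.sqrt_sq hc.le]

theorem gauss_a (p : ℕ) [Fact p.Prime] (hp : p ≠ 2) (a : ZMod p) (ha : a ≠ 0) :
    ∑ x : ZMod p, ZMod.stdAddChar (a * x ^ 2) =
      Real.sqrt p * (quadraticChar (ZMod p) a : ℂ) * (if p % 4 = 1 then 1 else Complex.I) := by
  have h1 := sum_sq_eq p hp 1 one_ne_zero
  simp only [one_mul, AddChar.mulShift_one] at h1
  have h2 := gaussSum_mulShift_eq (chiC p) ZMod.stdAddChar (Units.mk0 a ha)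
  rw [sum_sq_eq p hp a ha]
  rw [Units.val_mk0] at h2
  have h3 : (chiC p).IsQuadratic := (quadraticChar_isQuadratic _).comp _
  rw [h2, ← h1, gauss_one p hp, h3.inv]
  simp [chiC]
  ring_nf

theorem addChar_sum {A ι : Type*} [AddCommGroup A] (ψ : AddChar A ℂ) (s : Finset ι) (f : ι → A) :
    ψ (∑ i ∈ s, f i) = ∏ i ∈ s, ψ (f i) := by
  classical
  induction s using Finset.induction_on with
  | empty => simp
  | insert a s ha ih =>
    rw [Finset.sum_insert ha, Finset.prod_insert ha, AddChar.map_add_eq_mul, ih]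

open Matrix in
theorem exists_diag (p : ℕ) [Fact p.Prime] (hp : p ≠ 2) (n : ℕ)
    (Q : Matrix (Fin n) (Fin n) (ZMod p)) (hsym : Q.IsSymm) :
    ∃ P : Matrix (Fin n) (Fin n) (ZMod p), IsUnit P ∧ ∃ d, Pᵀ * Q * P = Matrix.diagonal d := by
  have : Invertible (2 : ZMod p) := invertibleOfNonzero (by
    intro h
    have : ((2 : ℕ) : ZMod p) = 0 := by exact_mod_cast h
    rw [ZMod.natCast_eq_zero_iff] at this
    exact hp ((Nat.prime_dvd_prime_iff_eq Fact.out Nat.prime_two).mp this))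
  have hB : (Matrix.toBilin' Q).IsSymm := ⟨fun x y => by
    simp only [Matrix.toBilin'_apply']
    rw [dotProduct_comm, ← Matrix.vecMul_transpose, hsym.eq, Matrix.dotProduct_mulVec]⟩
  have hB' : LinearMap.IsSymm (Matrix.toBilin' Q) := ⟨fun x y => hB.eq x y⟩
  obtain ⟨v, hv⟩ := LinearMap.BilinForm.exists_orthogonal_basis (B := Matrix.toBilin' Q) hB'
  let w := v.reindex (finCongr (by simp : Module.finrank (ZMod p) (Fin n → ZMod p) = n))
  have hw : ∀ i j, i ≠ j → Matrix.toBilin' Q (w i) (w j) = 0 := by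
    intro i j hij
    simp only [w, Module.Basis.reindex_apply]
    exact hv (by simpa using hij)
  refine ⟨(Pi.basisFun (ZMod p) (Fin n)).toMatrix w, ?_, fun i => Matrix.toBilin' Q (w i) (w i), ?_⟩
  · have := (Pi.basisFun (ZMod p) (Fin n)).invertibleToMatrix w
    exact isUnit_of_invertible _
  · ext i j
    have : ((((Pi.basisFun (ZMod p) (Fin n)).toMatrix w)ᵀ * Q * (Pi.basisFun (ZMod p) (Fin n)).toMatrix w) i j) = Matrix.toBilin' Q (w i) (w j) := by
      rw [Matrix.toBilin'_apply', Matrix.mul_assoc, Matrix.mul_apply]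
      simp only [dotProduct, Matrix.mul_apply, mulVec]
      rfl
    rw [this, Matrix.diagonal_apply]
    split_ifs with h
    · rw [h]
    · exact hw i j h


open Matrix in
/-- Gaussian sum over a finite field vector space: for `Q` a non-degenerate symmetric
matrix over `𝔽_ℓ`, `∑_{x ∈ 𝔽_ℓⁿ} e^{2πi xᵀQx/ℓ} = ℓ^{n/2} (det Q/ℓ) ε_ℓⁿ`. -/
theorem stmt12 (ℓ : ℕ) [Fact (Nat.Prime ℓ)] (hodd : ℓ ≠ 2) (n : ℕ)
    (Q : Matrix (Fin n) (Fin n) (ZMod ℓ)) (hsym : Q.IsSymm) (hdet : Q.det ≠ 0) :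
    ∑ x : Fin n → ZMod ℓ, Complex.exp
        (2 * (Real.pi : ℂ) * Complex.I * (((x ⬝ᵥ Q.mulVec x).val : ℂ)) / (ℓ : ℂ)) =
      ((Real.sqrt ℓ : ℂ)) ^ n * (legendreSym ℓ (Q.det.val : ℤ) : ℂ) *
        (if ℓ % 4 = 1 then 1 else Complex.I) ^ n := by
  obtain ⟨P, hP, d, hd⟩ := exists_diag ℓ hodd n Q hsym
  have hdP : P.det ≠ 0 := by
    rw [Matrix.isUnit_iff_isUnit_det] at hP; exact hP.ne_zero
  have hprod : P.det ^ 2 * Q.det = ∏ i, d i := by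
    rw [← Matrix.det_diagonal, ← hd, Matrix.det_mul, Matrix.det_mul, Matrix.det_transpose]; ring
  have hdi : ∀ i, d i ≠ 0 := by
    have : ∏ i, d i ≠ 0 := by rw [← hprod]; exact mul_ne_zero (pow_ne_zero _ hdP) hdet
    intro i; exact Finset.prod_ne_zero_iff.mp this i (Finset.mem_univ _)
  have hchar : legendreSym ℓ (Q.det.val : ℤ) = ∏ i, quadraticChar (ZMod ℓ) (d i) := by
    rw [← map_prod, ← hprod, map_mul, map_pow, quadraticChar_sq_one hdP, one_mul, legendreSym]
    simp
  have h1 : ∀ x : Fin n → ZMod ℓ, Complex.exp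
        (2 * (Real.pi : ℂ) * Complex.I * (((x ⬝ᵥ Q.mulVec x).val : ℂ)) / (ℓ : ℂ)) =
        ZMod.stdAddChar (x ⬝ᵥ Q.mulVec x) := by
    intro x; rw [← std_nat]; simp
  simp_rw [h1]
  have hbij : Function.Bijective (P.mulVec) :=
    ⟨Matrix.mulVec_injective_of_isUnit hP, Matrix.mulVec_surjective_iff_isUnit.mpr hP⟩
  rw [← hbij.sum_comp (fun x => ZMod.stdAddChar (x ⬝ᵥ Q.mulVec x))]
  have h2 : ∀ y : Fin n → ZMod ℓ, ZMod.stdAddChar (P.mulVec y ⬝ᵥ Q.mulVec (P.mulVec y)) =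
      ∏ i, ZMod.stdAddChar (d i * y i ^ 2) := by
    intro y
    have : P.mulVec y ⬝ᵥ Q.mulVec (P.mulVec y) = ∑ i, d i * y i ^ 2 := by
      rw [← Matrix.vecMul_transpose P y, ← Matrix.dotProduct_mulVec, Matrix.vecMul_transpose, Matrix.mulVec_mulVec,
        Matrix.mulVec_mulVec, hd]
      simp only [dotProduct, Matrix.mulVec_diagonal]
      exact Finset.sum_congr rfl fun i _ => by ring
    rw [this]; exact addChar_sum _ _ _
  simp_rw [h2]
  rw [← Fintype.prod_sum (fun i (t : ZMod ℓ) => (ZMod.stdAddChar (d i * t ^ 2) : ℂ)),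
    Finset.prod_congr rfl fun i _ => gauss_a ℓ hodd (d i) (hdi i), hchar,
    Finset.prod_mul_distrib, Finset.prod_mul_distrib]
  simp
end

section
/- Suppose S is a semisimple symplectic transformation of a 2g-dimensional symplectic vector space V over a finite field of odd characteristic. Then V decomposes as an orthogonal direct sum of S-invariant symplectic subspaces V = S₁ ⊕ S₋₁ ⊕ V₁ ⊕ ⋯ ⊕ V_r, where S₁ and S₋₁ are the eigenspaces of S for eigenvalues 1 and −1, and each restriction S|_{V_i} has squarefree characteristic polynomial (no repeated roots) with no root equal to ±1. -/
namespace Sympl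

section
variable {F V : Type*} [Field F] [AddCommGroup V] [Module F V]

/-- Invariant subspace. -/
def Inv (S : Module.End F V) (p : Submodule F V) : Prop := ∀ v ∈ p, S v ∈ p

/-- The form is non-degenerate on the subspace. -/
def ND (ω : LinearMap.BilinForm F V) (p : Submodule F V) : Prop :=
  ∀ v ∈ p, (∀ w ∈ p, ω v w = 0) → v = 0

/-- Cyclic subspace generated by a vector. -/
def cyc (S : Module.End F V) (v : V) : Submodule F V :=
  Submodule.span F (Set.range fun n : ℕ => (S ^ n) v)

lemma pow_mem_cyc (S : Module.End F V) (v : V) (n : ℕ) : (S ^ n) v ∈ cyc S v :=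
  Submodule.subset_span ⟨n, rfl⟩

lemma self_mem_cyc (S : Module.End F V) (v : V) : v ∈ cyc S v := by
  simpa using pow_mem_cyc S v 0

lemma inv_cyc (S : Module.End F V) (v : V) : Inv S (cyc S v) := by
  have : cyc S v ≤ (cyc S v).comap S := by
    conv_lhs => rw [cyc]
    rw [Submodule.span_le]
    rintro _ ⟨n, rfl⟩
    simpa [pow_succ'] using pow_mem_cyc S v (n + 1)
  exact fun x hx => this hx

lemma Inv.pow {S : Module.End F V} {p : Submodule F V} (h : Inv S p) {v : V} (hv : v ∈ p) (n : ℕ) :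
    (S ^ n) v ∈ p := by
  induction n with
  | zero => simpa using hv
  | succ n ih => simpa [pow_succ'] using h _ ih

lemma cyc_le {S : Module.End F V} {p : Submodule F V} (h : Inv S p) {v : V} (hv : v ∈ p) :
    cyc S v ≤ p := by
  rw [cyc, Submodule.span_le]
  rintro _ ⟨n, rfl⟩
  exact h.pow hv n

lemma Inv.inf {S : Module.End F V} {p q : Submodule F V} (hp : Inv S p) (hq : Inv S q) :
    Inv S (p ⊓ q) := fun v hv => ⟨hp v hv.1, hq v hv.2⟩

lemma Inv.sup {S : Module.End F V} {p q : Submodule F V} (hp : Inv S p) (hq : Inv S q) :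
    Inv S (p ⊔ q) := by
  intro v hv
  obtain ⟨a, ha, b, hb, rfl⟩ := Submodule.mem_sup.1 hv
  rw [map_add]
  exact Submodule.add_mem_sup (hp a ha) (hq b hb)

/-- Minimal among invariant subspaces (possibly zero). -/
def Simp (S : Module.End F V) (p : Submodule F V) : Prop :=
  ∀ q, Inv S q → q ≤ p → q = ⊥ ∨ q = p

lemma Simp.cyc_eq {S : Module.End F V} {p : Submodule F V} (h : Simp S p) (hi : Inv S p)
    {v : V} (hv : v ∈ p) (h0 : v ≠ 0) : cyc S v = p := by
  rcases h _ (inv_cyc S v) (cyc_le hi hv) with h | h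
  · have := self_mem_cyc S v
    rw [h] at this
    exact absurd ((Submodule.mem_bot F).1 this) h0
  · exact h

variable [FiniteDimensional F V]

lemma exists_simp (S : Module.End F V) (U : Submodule F V) (hU : Inv S U) (h0 : U ≠ ⊥) :
    ∃ A ≤ U, Inv S A ∧ Simp S A ∧ ∃ a ∈ A, a ≠ 0 := by
  obtain ⟨A, ⟨hA1, hA2, hA3⟩, hmin⟩ := (wellFounded_lt (α := Submodule F V)).has_min
    {p | p ≤ U ∧ Inv S p ∧ p ≠ ⊥} ⟨U, le_rfl, hU, h0⟩
  refine ⟨A, hA1, hA2, ?_, (Submodule.ne_bot_iff A).1 hA3⟩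
  intro q hq hle
  by_cases hb : q = ⊥
  · exact Or.inl hb
  · right
    by_contra hne
    exact hmin q ⟨hle.trans hA1, hq, hb⟩ (lt_of_le_of_ne hle hne)

lemma charpoly_eq_minpoly (T : Module.End F V) (v : V) (h : cyc T v = ⊤) :
    T.charpoly = minpoly F T := by
  have hm : (minpoly F T).Monic := minpoly.monic (Algebra.IsIntegral.isIntegral T)
  refine Polynomial.eq_of_monic_of_dvd_of_natDegree_le hm T.charpoly_monic
    (LinearMap.minpoly_dvd_charpoly T) ?_
  rw [LinearMap.charpoly_natDegree]
  let d := (minpoly F T).natDegree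
  let φ : Polynomial.degreeLT F d →ₗ[F] V :=
    (LinearMap.applyₗ v ∘ₗ (Polynomial.aeval T).toLinearMap) ∘ₗ (Polynomial.degreeLT F d).subtype
  have hs : Function.Surjective φ := by
    rw [← LinearMap.range_eq_top, eq_top_iff, ← h, cyc, Submodule.span_le]
    rintro _ ⟨n, rfl⟩
    refine ⟨⟨(Polynomial.X ^ n) %ₘ minpoly F T, ?_⟩, ?_⟩
    · rw [Polynomial.mem_degreeLT]
      have := Polynomial.degree_modByMonic_lt (Polynomial.X ^ n : Polynomial F) hm
      rwa [Polynomial.degree_eq_natDegree hm.ne_zero] at this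
    · simp [φ, minpoly.aeval_modByMonic_minpoly]
  have e := Polynomial.degreeLTEquiv F d
  have : Module.Finite F (Polynomial.degreeLT F d) := Module.Finite.equiv e.symm
  have h1 := LinearMap.finrank_le_finrank_of_surjective hs
  rw [e.finrank_eq] at h1
  simpa using h1

lemma cyc_restrict (S : Module.End F V) (W : Submodule F V) (h : ∀ v ∈ W, S v ∈ W) (v : V)
    (hv : v ∈ W) (hW : W = cyc S v) : cyc (S.restrict h) ⟨v, hv⟩ = ⊤ := by
  rw [eq_top_iff]
  have h1 : cyc S v ≤ (cyc (S.restrict h) ⟨v, hv⟩).map W.subtype := by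
    apply cyc_le
    · rintro _ ⟨x, hx, rfl⟩
      exact ⟨_, inv_cyc _ _ x hx, rfl⟩
    · exact ⟨_, self_mem_cyc _ _, rfl⟩
  rintro ⟨x, hx⟩ -
  obtain ⟨y, hy, hyx⟩ := h1 (hW ▸ hx)
  have : y = ⟨x, hx⟩ := Subtype.ext hyx
  exact this ▸ hy

variable {ω : LinearMap.BilinForm F V} {S : Module.End F V}

lemma inv_orth (hS : ∀ v w : V, ω (S v) (S w) = ω v w)
    (hinj : Function.Injective S) {N : Submodule F V} (hN : Inv S N) :
    Inv S (ω.orthogonal N) := by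
  intro v hv
  rw [LinearMap.BilinForm.mem_orthogonal_iff] at hv ⊢
  intro n hn
  have hs : Function.Surjective (S.restrict hN) := by
    apply LinearMap.surjective_of_injective
    intro x y hxy
    exact Subtype.ext (hinj (congrArg Subtype.val hxy))
  obtain ⟨⟨m, hm⟩, hmn⟩ := hs ⟨n, hn⟩
  have : S m = n := congrArg Subtype.val hmn
  rw [← this, hS]
  exact hv m hm

lemma isCompl_of_ND (halt : ω.IsAlt) {N : Submodule F V} (hN : ND ω N) :
    N ⊔ ω.orthogonal N = ⊤ := by
  have := (LinearMap.BilinForm.isCompl_orthogonal_iff_disjoint (W := N) halt.isRefl).2 (by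
    rw [Submodule.disjoint_def]
    intro x hx hx'
    refine hN x hx fun w hw => ?_
    exact halt.isRefl _ _ (hx' w hw))
  exact this.sup_eq_top

lemma key (halt : ω.IsAlt) (hS : ∀ v w : V, ω (S v) (S w) = ω v w)
    (hinj : Function.Injective S) (hss : S.IsSemisimple) (U : Submodule F V) (hU : Inv S U)
    (hnd : ND ω U) (h0 : U ≠ ⊥) (h1 : ∀ v ∈ U, S v = v → v = 0)
    (h2 : ∀ v ∈ U, S v = -v → v = 0) : ∃ v ∈ U, v ≠ 0 ∧ ND ω (cyc S v) := by
  by_contra! H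
  have refl : ∀ {x y : V}, ω x y = 0 → ω y x = 0 := fun {x y} h => halt.isRefl x y h
  have iso : ∀ A ≤ U, Inv S A → Simp S A → ∀ x ∈ A, ∀ y ∈ A, ω x y = 0 := by
    intro A hAU hA hs x hx y hy
    by_cases hx0 : x = 0
    · simp [hx0]
    have hc := hs.cyc_eq hA hx hx0
    have hH := H x (hAU hx) hx0
    rw [hc] at hH
    rcases hs (A ⊓ ω.orthogonal A) (hA.inf (inv_orth hS hinj hA)) inf_le_left with h | h
    · exfalso
      apply hH
      intro v hv hv'
      rw [← Submodule.mem_bot F, ← h]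
      exact ⟨hv, fun w hw => refl (hv' w hw)⟩
    · rw [← h] at hy
      exact hy.2 x hx
  obtain ⟨A, hAU, hA, hAs, a, ha, ha0⟩ := exists_simp S U hU h0
  have hAi := iso A hAU hA hAs
  have hO := hU.inf (inv_orth hS hinj hA)
  obtain ⟨C0, hC0, hcompl⟩ := Module.End.isSemisimple_iff.1 hss (U ⊓ ω.orthogonal A)
    (fun v hv => hO v hv)
  have hC0' : Inv S C0 := fun v hv => hC0 hv
  have hne : U ⊓ C0 ≠ ⊥ := by
    intro hbot
    apply ha0
    refine hnd a (hAU ha) fun u hu => ?_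
    have hu' : u ∈ (U ⊓ ω.orthogonal A) ⊔ C0 := by rw [hcompl.sup_eq_top]; trivial
    obtain ⟨o, ho, c, hc, rfl⟩ := Submodule.mem_sup.1 hu'
    have hcU : c ∈ U := by simpa using U.sub_mem hu ho.1
    have : c ∈ U ⊓ C0 := ⟨hcU, hc⟩
    rw [hbot, Submodule.mem_bot] at this
    rw [this, add_zero]
    exact ho.2 a ha
  obtain ⟨C, hCU, hC, hCs, c, hc, hc0⟩ := exists_simp S _ (hU.inf hC0') hne
  have hCi := iso C (hCU.trans inf_le_left) hC hCs
  have hCA : ∀ x ∈ C, (∀ y ∈ A, ω y x = 0) → x = 0 := by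
    intro x hx hxA
    exact Submodule.disjoint_def.1 hcompl.disjoint x ⟨(hCU hx).1, hxA⟩ (hCU hx).2
  have hAC : ∀ x ∈ A, (∀ y ∈ C, ω y x = 0) → x = 0 := by
    intro x hx hxC
    rcases hAs (A ⊓ ω.orthogonal C) (hA.inf (inv_orth hS hinj hC)) inf_le_left with h | h
    · rw [← Submodule.mem_bot F, ← h]
      exact ⟨hx, hxC⟩
    · exfalso
      apply hc0
      apply hCA c hc
      intro y hy
      rw [← h] at hy
      exact refl (hy.2 c hc)
  have hdis : ∀ x ∈ A, x ∈ C → x = 0 := fun x hx hx' => hCA x hx' fun y hy => hAi y hy x hx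
  have hNDAC : ND ω (A ⊔ C) := by
    intro v hv hv'
    obtain ⟨x, hx, y, hy, rfl⟩ := Submodule.mem_sup.1 hv
    have hy0 : y = 0 := by
      apply hCA y hy
      intro z hz
      have := hv' z (Submodule.mem_sup_left hz)
      rw [map_add, LinearMap.add_apply, hAi x hx z hz, zero_add] at this
      exact refl this
    subst hy0
    rw [add_zero]
    apply hAC x hx
    intro z hz
    have := hv' z (Submodule.mem_sup_right hz)
    rw [add_zero] at this
    exact refl this
  have hACU : A ⊔ C ≤ U := sup_le hAU (hCU.trans inf_le_left)
  have diag : ∀ y ∈ C, y ≠ 0 → ∀ i j : ℕ,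
      ω ((S ^ i) a) ((S ^ j) y) = ω ((S ^ j) a) ((S ^ i) y) := by
    intro y hy hy0
    have hmAC : a + y ∈ A ⊔ C := Submodule.add_mem_sup ha hy
    have hm0 : a + y ≠ 0 := by
      intro h
      apply hy0
      have : y = -a := by rw [eq_neg_iff_add_eq_zero, add_comm]; exact h
      exact hdis y (this ▸ A.neg_mem ha) hy
    have hMle : cyc S (a + y) ≤ A ⊔ C := cyc_le (hA.sup hC) hmAC
    have hMne : cyc S (a + y) ≠ A ⊔ C := by
      intro h
      exact H _ (hACU hmAC) hm0 (h ▸ hNDAC)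
    have hMi := inv_cyc S (a + y)
    have hmm := self_mem_cyc S (a + y)
    have hMA : a ∉ cyc S (a + y) := by
      intro h
      have h' : y ∈ cyc S (a + y) := by simpa using Submodule.sub_mem _ hmm h
      apply hMne
      refine le_antisymm hMle (sup_le ?_ ?_)
      · rw [← hAs.cyc_eq hA ha ha0]; exact cyc_le hMi h
      · rw [← hCs.cyc_eq hC hy hy0]; exact cyc_le hMi h'
    have hMC : ∀ z ∈ cyc S (a + y), z ∈ C → z = 0 := by
      intro z hz hzC
      rcases hCs _ (hMi.inf hC) inf_le_right with h | h
      · rw [← Submodule.mem_bot F, ← h]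
        exact ⟨hz, hzC⟩
      · exfalso
        have hy' := hy
        rw [← h] at hy'
        apply hMA
        simpa using Submodule.sub_mem _ hmm hy'.1
    have hMs : Simp S (cyc S (a + y)) := by
      intro p hp hpM
      rcases hAs _ ((hp.sup hC).inf hA) inf_le_right with h | h
      · left
        rw [eq_bot_iff]
        intro x hx
        obtain ⟨a', ha', c', hc', rfl⟩ := Submodule.mem_sup.1 (hMle (hpM hx))
        have : a' ∈ (p ⊔ C) ⊓ A := by
          refine ⟨?_, ha'⟩
          have := Submodule.sub_mem (p ⊔ C) (Submodule.mem_sup_left hx)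
            (Submodule.mem_sup_right hc')
          simpa using this
        rw [h, Submodule.mem_bot] at this
        subst this
        rw [zero_add] at hx ⊢
        exact hMC c' (hpM hx) hc'
      · right
        refine le_antisymm hpM (cyc_le hp ?_)
        have ha' := ha
        rw [← h] at ha'
        have : a + y ∈ p ⊔ C := Submodule.add_mem _ ha'.1 (Submodule.mem_sup_right hy)
        obtain ⟨r, hr, c', hc', hrc⟩ := Submodule.mem_sup.1 this
        have hc'' : c' = 0 := by
          apply hMC _ _ hc'
          have : c' = (a + y) - r := by rw [← hrc]; simp
          rw [this]
          exact Submodule.sub_mem _ hmm (hpM hr)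
        rw [← hrc, hc'', add_zero]
        exact hr
    intro i j
    have := iso _ (hMle.trans hACU) hMi hMs _ (pow_mem_cyc S _ i) _ (pow_mem_cyc S _ j)
    simp only [map_add, LinearMap.add_apply] at this
    rw [hAi _ (hA.pow ha i) _ (hA.pow ha j), hCi _ (hC.pow hy i) _ (hC.pow hy j),
      ← halt.neg_eq ((S ^ j) a) ((S ^ i) y)] at this
    linear_combination this
  have e1 := diag c hc hc0
  have e2 := diag (S c) (hC c hc) (fun h => hc0 (hinj (by rw [h, map_zero])))
  have e2' : ∀ i j : ℕ, ω ((S ^ i) a) ((S ^ (j+1)) c) = ω ((S ^ j) a) ((S ^ (i+1)) c) := by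
    intro i j
    simpa [pow_succ] using e2 i j
  have e3 : ∀ i j : ℕ, ω ((S ^ (i+1)) a) ((S ^ (j+1)) c) = ω ((S ^ i) a) ((S ^ j) c) := by
    intro i j
    rw [pow_succ', pow_succ']
    exact hS _ _
  have e4 : ∀ j : ℕ, ω ((S ^ 2) a) ((S ^ j) c) = ω ((S ^ 0) a) ((S ^ j) c) := by
    intro j
    cases j with
    | zero => rw [e1 2 0, e2' 0 1, e3 0 0]
    | succ j => rw [e3 1 j, e2' 0 j, e1 1 j]
  have e5 : (S ^ 2) a - a = 0 := by
    apply hAC _ (A.sub_mem (hA.pow ha 2) ha)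
    have : C ≤ LinearMap.ker (ω ((S ^ 2) a - a)) := by
      rw [← hCs.cyc_eq hC hc hc0, cyc, Submodule.span_le]
      rintro _ ⟨n, rfl⟩
      have := e4 n
      simp only [pow_zero, Module.End.one_apply] at this
      simp [this]
    intro y hy
    exact refl (this hy)
  have e6 : S (S a) = a := by
    rw [sub_eq_zero] at e5
    simpa [pow_succ] using e5
  have e7 : S a - a = 0 := by
    apply h2 _ (U.sub_mem (hU a (hAU ha)) (hAU ha))
    rw [map_sub, e6]; abel
  exact ha0 (h1 a (hAU ha) (sub_eq_zero.1 e7))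

lemma decomp (halt : ω.IsAlt) (hS : ∀ v w : V, ω (S v) (S w) = ω v w)
    (hinj : Function.Injective S) (hss : S.IsSemisimple) (n : ℕ) :
    ∀ (U : Submodule F V), Module.finrank F U = n → Inv S U →
    ND ω U → (∀ v ∈ U, S v = v → v = 0) → (∀ v ∈ U, S v = -v → v = 0) →
    ∃ (r : ℕ) (W : Fin r → Submodule F V), iSup W = U ∧
      (∀ i j, i ≠ j → ∀ v ∈ W i, ∀ w ∈ W j, ω v w = 0) ∧
      (∀ i, ND ω (W i)) ∧ ∀ i, ∃ v, W i = cyc S v := by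
  induction n using Nat.strong_induction_on with
  | _ n ih =>
  intro U hn hU hnd h1 h2
  by_cases h0 : U = ⊥
  · exact ⟨0, Fin.elim0, by simp [h0], fun i => i.elim0, fun i => i.elim0, fun i => i.elim0⟩
  obtain ⟨v, hv, hv0, hN⟩ := key halt hS hinj hss U hU hnd h0 h1 h2
  set N := cyc S v with hNdef
  have hNU : N ≤ U := cyc_le hU hv
  have hNi : Inv S N := inv_cyc S v
  have hsup : N ⊔ (U ⊓ ω.orthogonal N) = U := by
    have := isCompl_of_ND halt hN
    rw [inf_comm, ← sup_inf_assoc_of_le _ hNU, this, top_inf_eq]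
  have hlt : U ⊓ ω.orthogonal N < U := by
    refine lt_of_le_of_ne inf_le_left fun h => hv0 ?_
    have hvN := self_mem_cyc S v
    apply hN v hvN
    intro w hw
    have : v ∈ U ⊓ ω.orthogonal N := h.symm ▸ hv
    exact halt.isRefl _ _ (this.2 w hw)
  obtain ⟨r, W, hW1, hW2, hW3, hW4⟩ := ih _ (hn ▸ Submodule.finrank_lt_finrank_of_lt hlt) _ rfl
    (hU.inf (inv_orth hS hinj hNi)) (by
      intro x hx hx'
      apply hnd x hx.1
      intro w hw
      rw [← hsup] at hw
      obtain ⟨y, hy, z, hz, rfl⟩ := Submodule.mem_sup.1 hw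
      rw [map_add, hx' z hz, halt.isRefl _ _ (hx.2 y hy), add_zero])
    (fun v hv => h1 v hv.1) (fun v hv => h2 v hv.1)
  have hWle : ∀ i, W i ≤ ω.orthogonal N := fun i =>
    (le_iSup W i).trans (hW1.le.trans inf_le_right)
  refine ⟨r + 1, Fin.cons N W, ?_, ?_, ?_, ?_⟩
  · rw [← hsup, ← hW1]
    apply le_antisymm
    · refine iSup_le fun i => ?_
      refine Fin.cases ?_ (fun i => ?_) i
      · exact le_sup_left
      · exact (le_iSup W i).trans le_sup_right
    · refine sup_le ?_ (iSup_le fun i => ?_)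
      · exact le_iSup (Fin.cons N W : Fin (r+1) → Submodule F V) 0
      · exact le_iSup (Fin.cons N W : Fin (r+1) → Submodule F V) i.succ
  · intro i j
    refine Fin.cases ?_ (fun i => ?_) i <;> refine Fin.cases ?_ (fun j => ?_) j
    · intro h; exact absurd rfl h
    · intro _ v hv w hw
      exact hWle j hw v hv
    · intro _ v hv w hw
      exact halt.isRefl _ _ (hWle i hv w hw)
    · intro h
      exact hW2 i j (fun h' => h (h' ▸ rfl))
  · exact Fin.cases hN hW3
  · exact Fin.cases ⟨v, rfl⟩ hW4

lemma nd_eigen (hnd : ∀ v, (∀ w, ω v w = 0) → v = 0)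
    (hS : ∀ v w : V, ω (S v) (S w) = ω v w) (hss : S.IsSemisimple)
    (ε : F) (hε : ε * ε = 1) :
    ND ω (LinearMap.ker (S - algebraMap F (Module.End F V) ε)) := by
  set E := LinearMap.ker (S - algebraMap F (Module.End F V) ε) with hE
  have memE : ∀ x, x ∈ E ↔ S x = ε • x := by
    intro x; simp [hE, sub_eq_zero]
  have hEi : Inv S E := by
    intro x hx
    rw [memE] at hx ⊢
    rw [hx, map_smul, hx]
  obtain ⟨q, hq, hc⟩ := Module.End.isSemisimple_iff.1 hss E (fun v hv => hEi v hv)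
  have hq' : Inv S q := fun v hv => hq hv
  let T : Module.End F V := S - algebraMap F (Module.End F V) ε
  have hT : ∀ x ∈ q, T x ∈ q := by
    intro x hx
    simpa [T] using q.sub_mem (hq' x hx) (q.smul_mem ε hx)
  have hs : Function.Surjective (T.restrict hT) := by
    apply LinearMap.surjective_of_injective
    rw [← LinearMap.ker_eq_bot, LinearMap.ker_eq_bot']
    rintro ⟨x, hx⟩ h
    have h' : T x = 0 := congrArg Subtype.val h
    exact Subtype.ext (Submodule.disjoint_def.1 hc.disjoint x h' hx)
  intro e he he'
  apply hnd
  intro w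
  have hw : w ∈ E ⊔ q := by rw [hc.sup_eq_top]; trivial
  obtain ⟨x, hx, y, hy, rfl⟩ := Submodule.mem_sup.1 hw
  rw [map_add, he' x hx, zero_add]
  obtain ⟨⟨z, hz⟩, hzy⟩ := hs ⟨y, hy⟩
  have hzy' : T z = y := congrArg Subtype.val hzy
  have h3 := hS e z
  rw [(memE e).1 he] at h3
  simp only [map_smul, LinearMap.smul_apply, smul_eq_mul] at h3
  rw [← hzy']
  simp only [T, LinearMap.sub_apply, Module.algebraMap_end_apply, map_sub, map_smul, smul_eq_mul]
  linear_combination ε * h3 - (ω e (S z)) * hε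

lemma indep (halt : ω.IsAlt) {ι : Type*} (W : ι → Submodule F V)
    (ho : ∀ i j, i ≠ j → ∀ v ∈ W i, ∀ w ∈ W j, ω v w = 0) (hn : ∀ i, ND ω (W i)) :
    iSupIndep W := by
  intro i
  rw [Submodule.disjoint_def]
  intro x hx hx'
  apply hn i x hx
  intro w hw
  have : (⨆ j, ⨆ (_ : j ≠ i), W j) ≤ ω.orthogonal (W i) :=
    iSup₂_le fun j hj v hv => fun u hu => ho i j hj.symm u hu v hv
  exact halt.isRefl _ _ (this hx' w hw)

end

end Sympl

/-- A semisimple symplectic transformation decomposes the space as an orthogonal direct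
sum of invariant symplectic subspaces: the `1`- and `(−1)`-eigenspaces together with pieces
on which the characteristic polynomial is squarefree with no root `±1`. -/
theorem stmt15 {F V : Type*} [Field F] [Finite F] [AddCommGroup V] [Module F V]
    [FiniteDimensional F V] (g : ℕ) (hdim : Module.finrank F V = 2 * g)
    (hchar : (2 : F) ≠ 0)
    (ω : LinearMap.BilinForm F V) (halt : ω.IsAlt) (hnd : ω.Nondegenerate)
    (S : Module.End F V) (hS : ∀ v w : V, ω (S v) (S w) = ω v w)
    (hss : S.IsSemisimple) :
    ∃ (r : ℕ) (W : Fin (r + 2) → Submodule F V),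
      DirectSum.IsInternal W ∧
      W 0 = LinearMap.ker (S - 1) ∧
      W 1 = LinearMap.ker (S + 1) ∧
      (∀ i j, i ≠ j → ∀ v ∈ W i, ∀ w ∈ W j, ω v w = 0) ∧
      (∀ i, ∀ v ∈ W i, (∀ w ∈ W i, ω v w = 0) → v = 0) ∧
      ∃ hinv : ∀ i, ∀ v ∈ W i, S v ∈ W i,
        ∀ i : Fin (r + 2), 2 ≤ (i : ℕ) →
          Squarefree (LinearMap.charpoly (S.restrict (hinv i))) ∧
          ¬ (LinearMap.charpoly (S.restrict (hinv i))).IsRoot 1 ∧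
          ¬ (LinearMap.charpoly (S.restrict (hinv i))).IsRoot (-1) := by
  classical
  have hnd' : ∀ v, (∀ w, ω v w = 0) → v = 0 := fun v hv => hnd.1 v hv
  have hinj : Function.Injective S := by
    rw [← LinearMap.ker_eq_bot, LinearMap.ker_eq_bot']
    intro v hv
    apply hnd'
    intro w
    rw [← hS, hv, map_zero, LinearMap.zero_apply]
  have mem1 : ∀ x, x ∈ LinearMap.ker (S - 1) ↔ S x = x := by
    intro x; simp [sub_eq_zero]
  have mem2 : ∀ x, x ∈ LinearMap.ker (S + 1) ↔ S x = -x := by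
    intro x; simp [add_eq_zero_iff_eq_neg]
  have hN1 : Sympl.ND ω (LinearMap.ker (S - 1)) := by
    have := Sympl.nd_eigen hnd' hS hss 1 (by ring)
    rwa [map_one] at this
  have hN2 : Sympl.ND ω (LinearMap.ker (S + 1)) := by
    have := Sympl.nd_eigen hnd' hS hss (-1) (by ring)
    rwa [map_neg, map_one, sub_neg_eq_add] at this
  set E1 := LinearMap.ker (S - 1) with hE1
  set E2 := LinearMap.ker (S + 1) with hE2
  have hi1 : Sympl.Inv S E1 := by
    intro x hx
    rw [mem1] at hx ⊢
    rw [hx, hx]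
  have hi2 : Sympl.Inv S E2 := by
    intro x hx
    rw [mem2] at hx ⊢
    rw [hx, map_neg, hx]
  have h12 : ∀ v ∈ E1, ∀ w ∈ E2, ω v w = 0 := by
    intro v hv w hw
    have := hS v w
    rw [(mem1 v).1 hv, (mem2 w).1 hw, map_neg] at this
    have h2 : 2 * ω v w = 0 := by linear_combination -this
    exact (mul_eq_zero.1 h2).resolve_left hchar
  have hND : Sympl.ND ω (E1 ⊔ E2) := by
    intro v hv hv'
    obtain ⟨x, hx, y, hy, rfl⟩ := Submodule.mem_sup.1 hv
    have hx0 : x = 0 := by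
      apply hN1 x hx
      intro w hw
      have := hv' w (Submodule.mem_sup_left hw)
      rwa [map_add, LinearMap.add_apply, halt.isRefl _ _ (h12 w hw y hy), add_zero] at this
    have hy0 : y = 0 := by
      apply hN2 y hy
      intro w hw
      have := hv' w (Submodule.mem_sup_right hw)
      rwa [map_add, LinearMap.add_apply, h12 x hx w hw, zero_add] at this
    rw [hx0, hy0, add_zero]
  have hsup := Sympl.isCompl_of_ND halt hND
  have hUle1 : ∀ v ∈ ω.orthogonal (E1 ⊔ E2), ∀ w ∈ E1 ⊔ E2, ω v w = 0 := fun v hv w hw =>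
    halt.isRefl _ _ (hv w hw)
  have hno1 : ∀ v ∈ ω.orthogonal (E1 ⊔ E2), S v = v → v = 0 := fun v hv h =>
    hND v (Submodule.mem_sup_left ((mem1 v).2 h)) (hUle1 v hv)
  have hno2 : ∀ v ∈ ω.orthogonal (E1 ⊔ E2), S v = -v → v = 0 := fun v hv h =>
    hND v (Submodule.mem_sup_right ((mem2 v).2 h)) (hUle1 v hv)
  obtain ⟨r, W, hW1, hW2, hW3, hW4⟩ := Sympl.decomp halt hS hinj hss _
    (ω.orthogonal (E1 ⊔ E2)) rfl (Sympl.inv_orth hS hinj (hi1.sup hi2)) (by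
      intro v hv hv'
      apply hnd'
      intro w
      have hw : w ∈ (E1 ⊔ E2) ⊔ ω.orthogonal (E1 ⊔ E2) := by rw [hsup]; trivial
      obtain ⟨x, hx, y, hy, rfl⟩ := Submodule.mem_sup.1 hw
      rw [map_add, hUle1 v hv x hx, hv' y hy, add_zero]) hno1 hno2
  have hWle : ∀ i, W i ≤ ω.orthogonal (E1 ⊔ E2) := fun i => (le_iSup W i).trans hW1.le
  let W' : Fin (r + 2) → Submodule F V := Fin.cons E1 (Fin.cons E2 W)
  have hind : ∀ P : Fin (r + 2) → Prop, P 0 → P 1 → (∀ i : Fin r, P i.succ.succ) → ∀ i, P i :=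
    fun P p0 p1 p2 => Fin.cases p0 (Fin.cases p1 p2)
  have w0 : W' 0 = E1 := rfl
  have w1 : W' 1 = E2 := rfl
  have w2 : ∀ i : Fin r, W' i.succ.succ = W i := fun i => rfl
  have horth : ∀ i j, i ≠ j → ∀ v ∈ W' i, ∀ w ∈ W' j, ω v w = 0 := by
    refine hind _ ?_ ?_ fun i => ?_ <;> refine hind _ ?_ ?_ fun j => ?_
    · intro h; exact absurd rfl h
    · intro _; exact h12
    · intro _ v hv w hw
      exact hWle j hw v (Submodule.mem_sup_left hv)
    · intro _ v hv w hw
      exact halt.isRefl _ _ (h12 w hw v hv)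
    · intro h; exact absurd rfl h
    · intro _ v hv w hw
      exact hWle j hw v (Submodule.mem_sup_right hv)
    · intro _ v hv w hw
      exact halt.isRefl _ _ (hWle i hv w (Submodule.mem_sup_left hw))
    · intro _ v hv w hw
      exact halt.isRefl _ _ (hWle i hv w (Submodule.mem_sup_right hw))
    · intro h
      exact hW2 i j (fun h' => h (h' ▸ rfl))
  have hnd2 : ∀ i, Sympl.ND ω (W' i) := hind _ hN1 hN2 hW3
  have hinv : ∀ i, ∀ v ∈ W' i, S v ∈ W' i := by
    refine hind _ hi1 hi2 fun i => ?_
    obtain ⟨u, hu⟩ := hW4 i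
    rw [w2, hu]
    exact Sympl.inv_cyc S u
  refine ⟨r, W', ?_, w0, w1, horth, hnd2, hinv, ?_⟩
  · rw [DirectSum.isInternal_submodule_iff_iSupIndep_and_iSup_eq_top]
    refine ⟨Sympl.indep halt W' horth hnd2, ?_⟩
    rw [eq_top_iff, ← hsup, ← hW1]
    exact sup_le (sup_le (le_iSup W' 0) (le_iSup W' 1)) (iSup_le fun i => le_iSup W' i.succ.succ)
  · refine hind _ ?_ ?_ fun i => ?_
    · intro h; simp at h
    · intro h; simp at h
    · intro _
      obtain ⟨u, hu⟩ := hW4 i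
      have huW : u ∈ W' i.succ.succ := by
        rw [w2, hu]; exact Sympl.self_mem_cyc S u
      refine ⟨?_, ?_, ?_⟩
      · rw [Sympl.charpoly_eq_minpoly _ _ (Sympl.cyc_restrict S _ (hinv i.succ.succ) u huW hu)]
        exact (Module.End.IsSemisimple.restrict (hinv i.succ.succ) hss).minpoly_squarefree
      · rw [← Module.End.hasEigenvalue_iff_isRoot_charpoly]
        intro h
        obtain ⟨⟨x, hx⟩, hxe⟩ := h.exists_hasEigenvector
        have h3 := congrArg Subtype.val hxe.apply_eq_smul
        refine hxe.2 (Subtype.ext (hno1 x (hWle i hx) ?_))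
        simpa using h3
      · rw [← Module.End.hasEigenvalue_iff_isRoot_charpoly]
        intro h
        obtain ⟨⟨x, hx⟩, hxe⟩ := h.exists_hasEigenvector
        have h3 := congrArg Subtype.val hxe.apply_eq_smul
        refine hxe.2 (Subtype.ext (hno2 x (hWle i hx) ?_))
        simpa using h3
end
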